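/- arXiv:1903.01482 — 7 statements merged into one kernel-verified Lean document; each statement's English description precedes it below -/
import Mathlib

section
/- Let G = (V,E) be a finite simple connected non-bipartite undirected graph containing a cycle of odd length ḡ, and let K : V → ℝ be any function. Then there exists c : E → ℝ solving the constraint system for K and satisfying both ‖c‖₂² ≤ (ḡ/4)·|V|²·‖K‖² + (|V| − ḡ)·(|V| − ḡ + 1)²·‖K‖² and ‖c‖₂² ≤ (|V| − (3/4)ḡ)·‖K‖₁². -/
open scoped Classical
noncomputable section

namespace CS

variable {V : Type*} [Fintype V] [DecidableEq V]

/-- `c`, a real function on the edges of `H`, solves the constraint system for `K`: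
for every vertex `v`, the sum of `c` over the edges incident to `v` equals `-K v`. -/
def Solves (H : SimpleGraph V) (K : V → ℝ) (c : H.edgeFinset → ℝ) : Prop :=
  ∀ v : V, ∑ e : H.edgeFinset, (if v ∈ (e : Sym2 V) then c e else 0) = -K v

/-- `‖c‖₂²`, the sum of squares of the values of `c` over the edges. -/
def norm2 (H : SimpleGraph V) (c : H.edgeFinset → ℝ) : ℝ :=
  ∑ e : H.edgeFinset, c e ^ 2

/-- `‖K‖ = max_v |K v|`. -/
def kmax (K : V → ℝ) : ℝ := ⨆ v, |K v|

/-- The sum of `c` over the edges of `G` incident to `v`. -/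
def incSum (G : SimpleGraph V) (c : Sym2 V → ℝ) (v : V) : ℝ :=
  ∑ e ∈ G.edgeFinset, if v ∈ e then c e else 0

/-- The edge function alternating between `1` and `-1` along a walk, starting with `1`. -/
def altWalk {G : SimpleGraph V} : {a b : V} → G.Walk a b → Sym2 V → ℝ
  | _, _, .nil => fun _ => 0
  | a, _, .cons (v := m) _ p => fun e => (if e = s(a, m) then 1 else 0) - altWalk p e

lemma incSum_sub (G : SimpleGraph V) (c d : Sym2 V → ℝ) (v : V) :
    incSum G (fun e => c e - d e) v = incSum G c v - incSum G d v := by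
  unfold incSum
  rw [← Finset.sum_sub_distrib]
  refine Finset.sum_congr rfl fun e _ => ?_
  split_ifs <;> simp

lemma incSum_const_mul (G : SimpleGraph V) (r : ℝ) (c : Sym2 V → ℝ) (v : V) :
    incSum G (fun e => r * c e) v = r * incSum G c v := by
  unfold incSum
  rw [Finset.mul_sum]
  refine Finset.sum_congr rfl fun e _ => ?_
  split_ifs <;> simp

lemma incSum_sum (G : SimpleGraph V) (c : V → Sym2 V → ℝ) (v : V) :
    incSum G (fun e => ∑ u, c u e) v = ∑ u, incSum G (c u) v := by
  unfold incSum
  rw [Finset.sum_comm]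
  refine Finset.sum_congr rfl fun e _ => ?_
  split_ifs <;> simp

lemma incSum_single {G : SimpleGraph V} {a b : V} (h : G.Adj a b) (v : V) :
    incSum G (fun e => if e = s(a, b) then 1 else 0) v
      = (if v = a then 1 else 0) + (if v = b then 1 else 0) := by
  have hab := h.ne
  unfold incSum
  rw [Finset.sum_eq_single s(a, b)]
  · by_cases h1 : v = a <;> by_cases h2 : v = b <;> simp_all
  · intro e _ he
    simp [he]
  · intro he
    exact absurd (by simpa using h) he

lemma incSum_altWalk {G : SimpleGraph V} {a b : V} (w : G.Walk a b) (v : V) :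
    incSum G (altWalk w) v
      = (if v = a then 1 else 0) - (-1) ^ w.length * (if v = b then 1 else 0) := by
  induction w with
  | nil => simp [incSum, altWalk]
  | cons h p ih =>
    simp only [altWalk]
    rw [incSum_sub, incSum_single h, ih, SimpleGraph.Walk.length_cons, pow_succ]
    ring

omit [Fintype V] in
lemma altWalk_eq_zero {G : SimpleGraph V} {a b : V} (w : G.Walk a b) (e : Sym2 V)
    (he : e ∉ w.edges) : altWalk w e = 0 := by
  induction w with
  | nil => rfl
  | cons h p ih =>
    simp only [SimpleGraph.Walk.edges_cons, List.mem_cons, not_or] at he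
    simp [altWalk, he.1, ih he.2]

omit [Fintype V] in
lemma abs_altWalk_le {G : SimpleGraph V} {a b : V} (w : G.Walk a b) (hw : w.edges.Nodup)
    (e : Sym2 V) : |altWalk w e| ≤ 1 := by
  induction w with
  | nil => simp [altWalk]
  | cons h p ih =>
    simp only [SimpleGraph.Walk.edges_cons, List.nodup_cons] at hw
    simp only [altWalk]
    split_ifs with he
    · rw [altWalk_eq_zero p e (he ▸ hw.1)]
      simp
    · simpa using ih hw.2

omit [Fintype V] [DecidableEq V] in
lemma exists_adj_dist_lt {G : SimpleGraph V} (hconn : G.Connected) {u v : V} (h : u ≠ v) :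
    ∃ x, G.Adj u x ∧ G.dist x v < G.dist u v := by
  obtain ⟨w, hw⟩ := hconn.exists_walk_length_eq_dist u v
  cases w with
  | nil => exact absurd rfl h
  | cons hadj p =>
    refine ⟨_, hadj, ?_⟩
    rw [← hw, SimpleGraph.Walk.length_cons]
    exact Nat.lt_succ_of_le (SimpleGraph.dist_le p)

/-- A vertex of an odd cycle has a unit solution supported on the cycle with values at most
`1 / 2`. -/
lemma exists_unit_of_mem_cycle {G : SimpleGraph V} {v₀ : V} {w : G.Walk v₀ v₀}
    (hw : w.IsCycle) (hodd : Odd w.length) {u : V} (hu : u ∈ w.support) :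
    ∃ c : Sym2 V → ℝ, (∀ v, incSum G c v = if v = u then -1 else 0) ∧
      (∀ e, e ∉ w.edges → c e = 0) ∧ ∀ e, |c e| ≤ 1 / 2 := by
  have hperm := (w.rotate_edges u hu).perm
  refine ⟨fun e => (-1 / 2) * altWalk (w.rotate u hu) e, fun v => ?_, fun e he => ?_,
    fun e => ?_⟩
  · rw [incSum_const_mul, incSum_altWalk, SimpleGraph.Walk.length_rotate, hodd.neg_one_pow]
    split_ifs <;> norm_num
  · simp [altWalk_eq_zero _ _ fun h => he (hperm.mem_iff.1 h)]
  · have := abs_altWalk_le (w.rotate u hu) (hw.rotate hu).edges_nodup e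
    rw [abs_mul]
    norm_num
    linarith

/-- Unit solutions at arbitrary vertices, obtained by following the parent map `p` to the
cycle. -/
lemma exists_unit {G : SimpleGraph V} {v₀ : V} {w : G.Walk v₀ v₀}
    (hw : w.IsCycle) (hodd : Odd w.length) (p : V → V)
    (hp : ∀ u, u ∉ w.support → G.Adj u (p u) ∧ G.dist (p u) v₀ < G.dist u v₀) (u : V) :
    ∃ c : Sym2 V → ℝ, (∀ v, incSum G c v = if v = u then -1 else 0) ∧
      (∀ e, e ∉ w.edges → c e ≠ 0 → ∃ x, x ∉ w.support ∧ e = s(x, p x)) ∧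
      (∀ e, e ∉ w.edges → c e ≠ 0 → u ∉ w.support ∧ ∀ x ∈ e, G.dist x v₀ ≤ G.dist u v₀) ∧
      (∀ e ∈ w.edges, |c e| ≤ 1 / 2) ∧ ∀ e, |c e| ≤ 1 := by
  induction hd : G.dist u v₀ using Nat.strong_induction_on generalizing u with
  | _ n ih =>
    subst hd
    by_cases hu : u ∈ w.support
    · obtain ⟨c, h1, h2, h3⟩ := exists_unit_of_mem_cycle hw hodd hu
      exact ⟨c, h1, fun e he hc => absurd (h2 e he) hc, fun e he hc => absurd (h2 e he) hc,
        fun e _ => h3 e, fun e => (h3 e).trans (by norm_num)⟩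
    · obtain ⟨hadj, hlt⟩ := hp u hu
      obtain ⟨c, h1, h2, h3, h4, h5⟩ := ih _ hlt (p u) rfl
      have hnot : s(u, p u) ∉ w.edges := fun h => hu (w.fst_mem_support_of_mem_edges h)
      have hzero : c s(u, p u) = 0 := by
        by_contra hc
        have := (h3 _ hnot hc).2 u (by simp)
        omega
      refine ⟨fun e => (-1 * if e = s(u, p u) then 1 else 0) - c e, fun v => ?_,
        fun e he hc => ?_, fun e he hc => ⟨hu, fun x hx => ?_⟩, fun e he => ?_, fun e => ?_⟩
      · rw [incSum_sub, incSum_const_mul, incSum_single hadj, h1]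
        split_ifs <;> norm_num
      · by_cases hee : e = s(u, p u)
        · exact ⟨u, hu, hee⟩
        · exact h2 e he (by simpa [hee] using hc)
      · by_cases hee : e = s(u, p u)
        · subst hee
          rcases Sym2.mem_iff.1 hx with rfl | rfl
          · exact le_rfl
          · exact hlt.le
        · exact ((h3 e he (by simpa [hee] using hc)).2 x hx).trans hlt.le
      · have hee : e ≠ s(u, p u) := fun h => hnot (h ▸ he)
        simpa [hee] using h4 e he
      · by_cases hee : e = s(u, p u)
        · subst hee
          simp [hzero]
        · simpa [hee] using h5 e

omit [Fintype V] in
lemma card_support_of_isCycle {G : SimpleGraph V} {v : V} {w : G.Walk v v} (hw : w.IsCycle) :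
    w.support.toFinset.card = w.length := by
  have h : w.support.toFinset = w.support.tail.toFinset := by
    ext x
    simp only [List.mem_toFinset]
    refine ⟨fun hx => ?_, List.mem_of_mem_tail⟩
    rcases w.mem_support_iff.1 hx with rfl | hx
    · exact SimpleGraph.Walk.end_mem_tail_support hw.not_nil
    · exact hx
  rw [h, List.toFinset_card_of_nodup hw.support_nodup]
  simp

omit [DecidableEq V] in
lemma abs_le_kmax (K : V → ℝ) (v : V) : |K v| ≤ kmax K :=
  le_ciSup (f := fun v => |K v|) (Set.finite_range _).bddAbove v

omit [DecidableEq V] in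
lemma sum_abs_le_card_mul_kmax (K : V → ℝ) (s : Finset V) :
    ∑ v ∈ s, |K v| ≤ s.card * kmax K := by
  rw [← nsmul_eq_mul]
  exact Finset.sum_le_card_nsmul _ _ _ fun v _ => abs_le_kmax K v

/-- A solution of the constraint system supported on an odd cycle together with at most one edge
per vertex off the cycle. -/
lemma exists_solution_norm2_le {G : SimpleGraph V} (hconn : G.Connected) (K : V → ℝ) {v₀ : V}
    {w : G.Walk v₀ v₀} (hw : w.IsCycle) (hodd : Odd w.length) :
    ∃ c : G.edgeFinset → ℝ, Solves G K c ∧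
      norm2 G c ≤ (w.length : ℝ) * (1 / 2 * ∑ v, |K v|) ^ 2
        + ((w.support.toFinset)ᶜ.card : ℝ) * (∑ v ∈ (w.support.toFinset)ᶜ, |K v|) ^ 2 := by
  have hex : ∀ u, ∃ x, u ∉ w.support → G.Adj u x ∧ G.dist x v₀ < G.dist u v₀ := by
    intro u
    by_cases hu : u ∈ w.support
    · exact ⟨u, fun h => absurd hu h⟩
    · obtain ⟨x, hx⟩ := exists_adj_dist_lt hconn
        (show u ≠ v₀ from fun h => hu (h ▸ w.start_mem_support))
      exact ⟨x, fun _ => hx⟩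
  choose p hp using hex
  choose c h1 h2 h3 h4 h5 using exists_unit hw hodd p hp
  set S := w.support.toFinset with hS
  set C := w.edges.toFinset with hC
  set F := Sᶜ.image fun x => s(x, p x) with hF
  set d : Sym2 V → ℝ := fun e => ∑ u, K u * c u e with hd
  have hdC : ∀ e ∈ C, d e ^ 2 ≤ (1 / 2 * ∑ v, |K v|) ^ 2 := by
    intro e he
    rw [hC, List.mem_toFinset] at he
    refine sq_le_sq' (abs_le.1 ?_).1 (abs_le.1 ?_).2 <;>
    · refine (Finset.abs_sum_le_sum_abs _ _).trans ?_
      rw [Finset.mul_sum]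
      refine Finset.sum_le_sum fun u _ => ?_
      rw [abs_mul, mul_comm]
      exact mul_le_mul_of_nonneg_right (h4 u e he) (abs_nonneg _)
  have hdF : ∀ e, e ∉ C → d e ^ 2 ≤ (∑ v ∈ Sᶜ, |K v|) ^ 2 := by
    intro e he
    rw [hC, List.mem_toFinset] at he
    have hsub : d e = ∑ u ∈ Sᶜ, K u * c u e := by
      refine (Finset.sum_subset (Finset.subset_univ _) fun u _ hu => ?_).symm
      by_contra hne
      refine hu ?_
      simpa [hS] using (h3 u e he (right_ne_zero_of_mul hne)).1
    rw [hsub]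
    refine sq_le_sq' (abs_le.1 ?_).1 (abs_le.1 ?_).2 <;>
    · refine (Finset.abs_sum_le_sum_abs _ _).trans (Finset.sum_le_sum fun u _ => ?_)
      rw [abs_mul]
      exact mul_le_of_le_one_right (abs_nonneg _) (h5 u e)
  have hsupp : ∀ e, e ∉ C → e ∉ F → d e = 0 := by
    intro e he heF
    rw [hC, List.mem_toFinset] at he
    refine Finset.sum_eq_zero fun u _ => ?_
    by_contra hne
    obtain ⟨x, hx, rfl⟩ := h2 u e he (right_ne_zero_of_mul hne)
    exact heF (Finset.mem_image_of_mem _ (by simpa [hS] using hx))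
  refine ⟨fun e => d e, fun v => ?_, ?_⟩
  · have h := incSum_sum G (fun u e => K u * c u e) v
    simp only [incSum_const_mul, h1] at h
    simp only [mul_ite, mul_neg, mul_one, mul_zero, Finset.sum_ite_eq, Finset.mem_univ,
      if_true] at h
    rw [← h, incSum, ← Finset.sum_coe_sort G.edgeFinset fun e => if v ∈ e then d e else 0]
  · have hsplit : norm2 G (fun e => d e) ≤ ∑ e ∈ C, d e ^ 2 + ∑ e ∈ F \ C, d e ^ 2 := by
      rw [norm2, Finset.sum_coe_sort G.edgeFinset fun e => d e ^ 2,
        ← Finset.sum_union Finset.disjoint_sdiff]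
      rw [← Finset.sum_filter_ne_zero]
      refine Finset.sum_le_sum_of_subset_of_nonneg (fun e he => ?_) fun _ _ _ => sq_nonneg _
      have hne := (Finset.mem_filter.1 he).2
      by_contra hmem
      simp only [Finset.mem_union, Finset.mem_sdiff, not_or, not_and, not_not] at hmem
      exact hne (by rw [hsupp e hmem.1 fun hf => hmem.1 (hmem.2 hf), zero_pow two_ne_zero])
    have hCcard : C.card ≤ w.length := by
      simpa using w.edges.toFinset_card_le
    have hFcard : (F \ C).card ≤ Sᶜ.card :=
      (Finset.card_le_card Finset.sdiff_subset).trans Finset.card_image_le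
    refine hsplit.trans (add_le_add ?_ ?_)
    · refine (Finset.sum_le_card_nsmul _ _ _ hdC).trans ?_
      rw [nsmul_eq_mul]
      gcongr
    · refine (Finset.sum_le_card_nsmul _ _ _ fun e he =>
        hdF e (Finset.mem_sdiff.1 he).2).trans ?_
      rw [nsmul_eq_mul]
      gcongr

/-- For a finite simple connected non-bipartite graph `G` containing a cycle of
odd length `g` and any `K : V → ℝ`, there is a solution `c` of the constraint system for `K`
with `‖c‖₂² ≤ (g/4)|V|²‖K‖² + (|V|−g)(|V|−g+1)²‖K‖²` and `‖c‖₂² ≤ (|V| − (3/4)g)‖K‖₁²`. -/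
theorem statement6 (G : SimpleGraph V) (K : V → ℝ) (g : ℕ)
    (hconn : G.Connected) (hnonbip : ¬ G.Colorable 2) (hodd : Odd g)
    (hcyc : ∃ (v : V) (w : G.Walk v v), w.IsCycle ∧ w.length = g) :
    ∃ c : G.edgeFinset → ℝ, Solves G K c ∧
      norm2 G c ≤ ((g : ℝ) / 4) * (Fintype.card V : ℝ) ^ 2 * kmax K ^ 2
          + ((Fintype.card V : ℝ) - g) * ((Fintype.card V : ℝ) - g + 1) ^ 2 * kmax K ^ 2 ∧
      norm2 G c ≤ ((Fintype.card V : ℝ) - (3 / 4 : ℝ) * g) * (∑ v, |K v|) ^ 2 := by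
  obtain ⟨v₀, w, hw, rfl⟩ := hcyc
  obtain ⟨c, hc, hle⟩ := exists_solution_norm2_le hconn K hw hodd
  have hcard : ((w.support.toFinset)ᶜ.card : ℝ) = Fintype.card V - w.length := by
    rw [← card_support_of_isCycle hw, Finset.card_compl, Nat.cast_sub (Finset.card_le_univ _)]
  have hA := sum_abs_le_card_mul_kmax K Finset.univ
  have hB := sum_abs_le_card_mul_kmax K (w.support.toFinset)ᶜ
  have hBA : ∑ v ∈ (w.support.toFinset)ᶜ, |K v| ≤ ∑ v, |K v| :=
    Finset.sum_le_sum_of_subset_of_nonneg (Finset.subset_univ _) fun _ _ _ => abs_nonneg _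
  have hB0 : 0 ≤ ∑ v ∈ (w.support.toFinset)ᶜ, |K v| := Finset.sum_nonneg fun _ _ => abs_nonneg _
  have hm : (0 : ℝ) ≤ ((w.support.toFinset)ᶜ.card : ℝ) := Nat.cast_nonneg _
  have hk : 0 ≤ kmax K := (abs_nonneg _).trans (abs_le_kmax K v₀)
  rw [hcard] at hle hB hm
  rw [Finset.card_univ] at hA
  have hg : (0 : ℝ) ≤ w.length := Nat.cast_nonneg _
  refine ⟨c, hc, hle.trans ?_, hle.trans ?_⟩
  · have e1 := mul_le_mul_of_nonneg_left (pow_le_pow_left₀ (hB0.trans hBA) hA 2) hg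
    have hB' : ∑ v ∈ (w.support.toFinset)ᶜ, |K v|
        ≤ ((Fintype.card V : ℝ) - w.length + 1) * kmax K := by linarith
    have e2 := mul_le_mul_of_nonneg_left (pow_le_pow_left₀ hB0 hB' 2) hm
    rw [mul_pow] at e1 e2
    linarith
  · have e2 := mul_le_mul_of_nonneg_left (pow_le_pow_left₀ hB0 hBA 2) hm
    linarith

end CS
end
end

section
/- Let G = (V,E) be a finite simple connected bipartite undirected graph containing a cycle of length ḡ, with bipartition classes A and B of equal size |A| = |B|, and let K : V → ℝ be the constant function K(v) = k for all v. Then there exists c : E → ℝ solving the constraint system for K and satisfying ‖c‖₂² ≤ |V|·(|V| − ḡ + 1)²·k². -/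
open scoped Classical
noncomputable section

namespace CS

variable {V : Type*} [Fintype V] [DecidableEq V]

/-- Some `c`, vanishing off the edges of `G` inside `S`, solves the constraint system for `K` on `S`
with `‖c‖₂² ≤ |S| R`. -/
def HasSolution (G : SimpleGraph V) (R : ℝ) (S : Finset V) (K : V → ℝ) : Prop :=
  ∃ c : Sym2 V → ℝ, (∀ e, c e ≠ 0 → e ∈ G.edgeSet ∧ ∀ x ∈ e, x ∈ S) ∧
    (∀ v ∈ S, ∑ e, (if v ∈ e then c e else 0) = -K v) ∧ ∑ e, c e ^ 2 ≤ S.card * R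

/-- Attaching a leaf `u` to a vertex `w` of `S`. -/
lemma HasSolution.insert_leaf {G : SimpleGraph V} {R : ℝ} {S : Finset V} {K : V → ℝ} {u w : V}
    (hu : u ∉ S) (hw : w ∈ S) (huw : G.Adj u w) (hR : K u ^ 2 ≤ R)
    (h : HasSolution G R S (Function.update K w (K w - K u))) :
    HasSolution G R (insert u S) K := by
  obtain ⟨c, hsupp, hsol, hnorm⟩ := h
  have h0 : ∀ e, u ∈ e → c e = 0 := fun e he => by
    by_contra hne
    exact hu ((hsupp e hne).2 u he)
  have hce : c s(u, w) = 0 := h0 _ (Sym2.mem_mk_left u w)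
  have hsum : ∀ v, ∑ e, (if v ∈ e then Function.update c s(u, w) (-K u) e else 0) =
      ∑ e, (if v ∈ e then c e else 0) + if v ∈ s(u, w) then -K u else 0 := by
    intro v
    have : ∀ e, (if v ∈ e then Function.update c s(u, w) (-K u) e else 0) =
        (if v ∈ e then c e else 0) +
          if e = s(u, w) then (if v ∈ s(u, w) then -K u else 0) else 0 := by
      intro e
      by_cases he : e = s(u, w)
      · subst he
        simp [hce]
      · simp [he]
    simp [Finset.sum_congr rfl fun e _ => this e, Finset.sum_add_distrib]
  refine ⟨Function.update c s(u, w) (-K u), ?_, ?_, ?_⟩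
  · intro e he
    by_cases h : e = s(u, w)
    · subst h
      refine ⟨huw, fun x hx => ?_⟩
      rcases Sym2.mem_iff.1 hx with rfl | rfl <;> simp [hw]
    · rw [Function.update_of_ne h] at he
      exact ⟨(hsupp e he).1, fun x hx => Finset.mem_insert_of_mem ((hsupp e he).2 x hx)⟩
  · intro v hv
    rw [hsum]
    rcases Finset.mem_insert.1 hv with rfl | hvS
    · rw [Finset.sum_eq_zero fun e _ => ?_]
      · simp
      · split_ifs with he
        · exact h0 e he
        · rfl
    · have hvu : v ≠ u := fun h => hu (h ▸ hvS)
      rw [hsol v hvS]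
      by_cases hvw : v = w
      · subst hvw
        simp only [Function.update_self, Sym2.mem_mk_right, if_true]
        ring
      · simp [hvw, hvu]
  · have : ∀ e, Function.update c s(u, w) (-K u) e ^ 2 =
        c e ^ 2 + if e = s(u, w) then K u ^ 2 else 0 := by
      intro e
      by_cases he : e = s(u, w)
      · subst he
        simp [hce]
      · simp [he]
    rw [Finset.sum_congr rfl fun e _ => this e, Finset.sum_add_distrib, Finset.card_insert_of_notMem hu]
    simp only [Finset.sum_ite_eq', Finset.mem_univ, if_true]
    push_cast
    linarith

/-- The constraint system on `S` has a small solution for each `ε`-balanced `K` that is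
`M`-close to `a` in `ℓ¹(S)`. -/
def SolvableNear (G : SimpleGraph V) (ε : V → ℝ) (r M : ℝ) (a : V → ℝ) (S : Finset V) : Prop :=
  ∀ K : V → ℝ, ∑ v ∈ S, ε v * K v = 0 → ∑ v ∈ S, |K v - a v| ≤ M →
    HasSolution G ((r + M) ^ 2) S K

lemma SolvableNear.insert_leaf {G : SimpleGraph V} {ε : V → ℝ} {r M : ℝ} {a : V → ℝ} {S : Finset V}
    {u w : V} (hu : u ∉ S) (hw : w ∈ S) (huw : G.Adj u w) (hε : ε u = -ε w) (ha : |a u| ≤ r)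
    (h : SolvableNear G ε r M (Function.update a w (a w - a u)) S) :
    SolvableNear G ε r M a (insert u S) := by
  intro K hbal hclose
  rw [Finset.sum_insert hu] at hbal hclose
  have hM : |K u - a u| ≤ M :=
    (le_add_of_nonneg_right (Finset.sum_nonneg fun _ _ => abs_nonneg _)).trans hclose
  refine HasSolution.insert_leaf hu hw huw ?_ (h _ ?_ ?_)
  · refine sq_le_sq' ?_ ?_ <;>
    linarith [abs_le.1 ha, abs_le.1 hM]
  · rw [← Finset.add_sum_erase _ _ hw] at hbal ⊢
    rw [Finset.sum_congr rfl fun v hv => by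
      rw [Function.update_of_ne (Finset.ne_of_mem_erase hv)]]
    rw [Function.update_self]
    rw [hε] at hbal
    linarith
  · rw [← Finset.add_sum_erase _ _ hw] at hclose ⊢
    rw [Finset.sum_congr rfl fun v hv => by
      rw [Function.update_of_ne (Finset.ne_of_mem_erase hv),
        Function.update_of_ne (Finset.ne_of_mem_erase hv)]]
    simp only [Function.update_self]
    have : |K w - K u - (a w - a u)| ≤ |K w - a w| + |K u - a u| := by
      rw [show K w - K u - (a w - a u) = (K w - a w) - (K u - a u) by ring]
      exact abs_sub _ _
    linarith

lemma solvableNear_path {G : SimpleGraph V} {ε : V → ℝ} (hε0 : ∀ v, ε v ≠ 0)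
    (hε : ∀ u w, G.Adj u w → ε u = -ε w) (k M : ℝ) (l : List V) :
    ∀ (v : V) (a : V → ℝ), (v :: l).IsChain G.Adj → (v :: l).Nodup → (a v = 0 ∨ a v = k) →
      (∀ u ∈ l, a u = k) → SolvableNear G ε |k| M a (v :: l).toFinset := by
  induction l with
  | nil =>
    intro v a _ _ _ _ K hbal _
    have hK : K v = 0 := by simpa [hε0 v] using hbal
    refine ⟨0, by simp, by simp [hK], ?_⟩
    simp only [Pi.zero_apply, ne_eq, OfNat.ofNat_ne_zero, not_false_eq_true, zero_pow,
      Finset.sum_const_zero]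
    positivity
  | cons w l ih =>
    intro v a hchain hnodup hav hal
    obtain ⟨hvw, hchain⟩ := List.isChain_cons_cons.1 hchain
    obtain ⟨hv, hnodup⟩ := List.nodup_cons.1 hnodup
    have haw : a w = k := hal w List.mem_cons_self
    rw [List.toFinset_cons]
    refine SolvableNear.insert_leaf (by simpa using hv) (by simp) hvw (hε _ _ hvw) ?_
      (ih w _ hchain hnodup ?_ ?_)
    · rcases hav with h | h <;> simp [h]
    · rcases hav with h | h <;> simp [h, haw]
    · intro u hu
      have : u ≠ w := fun h => (List.nodup_cons.1 hnodup).1 (h ▸ hu)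
      rw [Function.update_of_ne this]
      exact hal u (List.mem_cons_of_mem _ hu)

lemma exists_adj_notMem_of_connected {G : SimpleGraph V} (hconn : G.Connected) {S : Finset V}
    (hS : S.Nonempty) (hne : S ≠ Finset.univ) : ∃ u w, u ∉ S ∧ w ∈ S ∧ G.Adj u w := by
  obtain ⟨x, hx⟩ := hS
  obtain ⟨y, hy⟩ : ∃ y, y ∉ S := by
    by_contra! h
    exact hne (Finset.eq_univ_of_forall h)
  obtain ⟨p⟩ := hconn.preconnected x y
  obtain ⟨d, -, hd, hd'⟩ := p.exists_boundary_dart (S : Set V) hx hy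
  exact ⟨d.snd, d.fst, hd', hd, d.adj.symm⟩

lemma SolvableNear.univ {G : SimpleGraph V} (hconn : G.Connected) {ε : V → ℝ}
    (hε : ∀ u w, G.Adj u w → ε u = -ε w) {r M : ℝ} (hr : 0 ≤ r) {a : V → ℝ} {P : Finset V}
    (hP : P.Nonempty) (ha : ∀ v ∉ P, a v = 0) (h : SolvableNear G ε r M a P) :
    SolvableNear G ε r M a Finset.univ := by
  let good := Finset.univ.filter fun S : Finset V => P ⊆ S ∧ SolvableNear G ε r M a S
  have hgood : good.Nonempty := ⟨P, by simp [good, h]⟩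
  obtain ⟨S, hS, hmax⟩ := good.exists_max_image Finset.card hgood
  obtain ⟨hPS, hsol⟩ := (Finset.mem_filter.1 hS).2
  by_cases hne : S = Finset.univ
  · rwa [← hne]
  obtain ⟨u, w, hu, hw, huw⟩ := exists_adj_notMem_of_connected hconn (hP.mono hPS) hne
  have hau : a u = 0 := ha u fun h => hu (hPS h)
  have hins : SolvableNear G ε r M a (insert u S) :=
    SolvableNear.insert_leaf hu hw huw (hε _ _ huw) (by simpa [hau] using hr) (by simpa [hau] using hsol)
  have := hmax (insert u S) (Finset.mem_filter.2
    ⟨Finset.mem_univ _, hPS.trans (Finset.subset_insert _ _), hins⟩)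
  rw [Finset.card_insert_of_notMem hu] at this
  omega

/-- For a finite simple connected bipartite graph `G` containing a cycle of
length `g`, with bipartition classes `A`, `B` of equal size, and the constant function
`K ≡ k`, there is a solution `c` of the constraint system with
`‖c‖₂² ≤ |V|·(|V|−g+1)²·k²`. -/
theorem statement8 (G : SimpleGraph V) (A B : Finset V) (k : ℝ) (g : ℕ)
    (hconn : G.Connected)
    (hAB : ∀ v : V, v ∈ A ↔ v ∉ B)
    (hbip : ∀ v w : V, G.Adj v w → ((v ∈ A ∧ w ∈ B) ∨ (v ∈ B ∧ w ∈ A)))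
    (hcard : A.card = B.card)
    (hcyc : ∃ (v : V) (w : G.Walk v v), w.IsCycle ∧ w.length = g) :
    ∃ c : G.edgeFinset → ℝ, Solves G (fun _ => k) c ∧
      norm2 G c ≤ (Fintype.card V : ℝ) * ((Fintype.card V : ℝ) - g + 1) ^ 2 * k ^ 2 := by
  obtain ⟨v₀, p, hp, rfl⟩ := hcyc
  let ε : V → ℝ := fun v => if v ∈ A then 1 else -1
  have hε0 : ∀ v, ε v ≠ 0 := fun v => by
    by_cases h : v ∈ A <;> simp [ε, h]
  have hε : ∀ u w, G.Adj u w → ε u = -ε w := by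
    intro u w huw
    rcases hbip u w huw with ⟨h₁, h₂⟩ | ⟨h₁, h₂⟩
    · have : w ∉ A := fun h => (hAB w).1 h h₂
      simp [ε, h₁, this]
    · have : u ∉ A := fun h => (hAB u).1 h h₁
      simp [ε, h₂, this]
  have hbal : ∑ v, ε v * k = 0 := by
    have hB : Finset.univ.filter (fun v => v ∉ A) = B := by
      ext v
      simp [hAB v]
    have hA : Finset.univ.filter (fun v => v ∈ A) = A := by
      ext v
      simp
    rw [← Finset.sum_mul, Finset.sum_ite, hA, hB]
    simp [hcard]
  have hnodup : p.support.tail.Nodup := hp.support_nodup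
  have hchain : p.support.tail.IsChain G.Adj := p.isChain_adj_support.tail
  have hlen : p.support.tail.length = p.length := by simp
  have hpos : 3 ≤ p.length := hp.three_le_length
  obtain ⟨v, l, hvl⟩ : ∃ v l, p.support.tail = v :: l :=
    List.exists_cons_of_ne_nil (List.ne_nil_of_length_pos (by omega))
  rw [hvl] at hnodup hchain hlen
  let P := (v :: l).toFinset
  have hPcard : P.card = p.length := by rw [List.toFinset_card_of_nodup hnodup, hlen]
  let a : V → ℝ := fun u => if u ∈ P then k else 0
  have ha : ∀ u ∈ v :: l, a u = k := fun u hu => if_pos (List.mem_toFinset.2 hu)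
  have hclose : ∑ u, |k - a u| ≤ ((Fintype.card V : ℝ) - p.length) * |k| := by
    have : ∀ u, |k - a u| = if u ∈ Pᶜ then |k| else 0 := by
      intro u
      by_cases h : u ∈ P <;> simp [a, h]
    rw [Finset.sum_congr rfl fun u _ => this u, Finset.sum_ite_mem, Finset.univ_inter,
      Finset.sum_const, nsmul_eq_mul, Finset.card_compl, Nat.cast_sub (Finset.card_le_univ P),
      hPcard]
  obtain ⟨c, hsupp, hsol, hnorm⟩ := SolvableNear.univ hconn hε (abs_nonneg k) (P := P)
    ⟨v, by simp [P]⟩ (fun u hu => if_neg hu)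
    (solvableNear_path hε0 hε k _ l v a hchain hnodup (Or.inr (ha v List.mem_cons_self))
      fun u hu => ha u (List.mem_cons_of_mem _ hu)) (fun _ => k) hbal hclose
  have hsum : ∀ f : Sym2 V → ℝ, (∀ e, c e = 0 → f e = 0) → ∑ e : G.edgeFinset, f e = ∑ e, f e := by
    intro f hf
    rw [Finset.sum_coe_sort G.edgeFinset f]
    refine Finset.sum_subset (Finset.subset_univ _) fun e _ he => hf e ?_
    by_contra hne
    exact he (SimpleGraph.mem_edgeFinset.2 (hsupp e hne).1)
  refine ⟨fun e => c e, fun u => ?_, ?_⟩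
  · rw [← hsol u (Finset.mem_univ u)]
    exact hsum (fun e => if u ∈ e then c e else 0) fun e he => by simp [he]
  · refine ((hsum (fun e => c e ^ 2) fun e he => by simp [he]).le.trans hnorm).trans_eq ?_
    rw [Finset.card_univ, ← sq_abs k]
    ring

end CS
end
end

section
/- Let T = (V,E) be a finite tree with at least two vertices, with bipartition classes A and B, and let K : V → ℝ satisfy Σ_{a∈A} K(a) = Σ_{b∈B} K(b). Then the constraint system for K has a unique solution c : E → ℝ, and for every choice of root v ∈ V the solution satisfies ‖c‖₂² ≤ Σ_{u ∈ V∖{v}} ( Σ_{w ∈ D(u)} |K(w)| )², where D(u) is the set of descendants of u in the tree rooted at v (vertices whose unique path to v passes through u, including u itself). -/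
open scoped Classical
noncomputable section

namespace CS

variable {V : Type*} [Fintype V] [DecidableEq V]

/-- The descendants of `u` in the tree `G` rooted at `v`: the vertices whose
(unique) path to the root `v` passes through `u` (`u` being its own descendant). -/
def descendants (G : SimpleGraph V) (v u : V) : Finset V :=
  Finset.univ.filter fun w => ∀ p : G.Walk w v, p.IsPath → u ∈ p.support

set_option linter.unusedSectionVars false

section Descendants

variable {T : SimpleGraph V} {v : V}

lemma notMem_descendants {u w : V} :
    w ∉ descendants T v u ↔ ∃ p : T.Walk w v, p.IsPath ∧ u ∉ p.support := by
  simp [descendants]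

lemma notMem_descendants_of_walk {u w : V} (p : T.Walk w v) (hp : u ∉ p.support) :
    w ∉ descendants T v u :=
  notMem_descendants.2 ⟨p.bypass, p.bypass_isPath, fun h => hp (p.support_bypass_subset_support h)⟩

lemma self_mem_descendants (u : V) : u ∈ descendants T v u := by
  simp [descendants]

lemma mem_descendants_root (w : V) : w ∈ descendants T v v := by
  simp [descendants]

lemma notMem_descendants_of_adj {u a b : V} (hab : T.Adj a b) (ha : a ≠ u)
    (hb : b ∉ descendants T v u) : a ∉ descendants T v u := by
  obtain ⟨p, -, hp⟩ := notMem_descendants.1 hb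
  exact notMem_descendants_of_walk (.cons hab p) (by simp [hp, ha.symm])

lemma mem_descendants_iff_of_adj {u a b : V} (hab : T.Adj a b) (ha : a ≠ u) (hb : b ≠ u) :
    a ∈ descendants T v u ↔ b ∈ descendants T v u :=
  not_iff_not.1 ⟨notMem_descendants_of_adj hab.symm hb, notMem_descendants_of_adj hab ha⟩

lemma parent_unique (hT : T.IsTree) {u a b : V} (ha : T.Adj u a) (hb : T.Adj u b)
    (hda : a ∉ descendants T v u) (hdb : b ∉ descendants T v u) : a = b := by
  obtain ⟨p, hp, hup⟩ := notMem_descendants.1 hda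
  obtain ⟨q, hq, huq⟩ := notMem_descendants.1 hdb
  have h := (hT.existsUnique_path u v).unique (hp.cons hup (h := ha)) (hq.cons huq (h := hb))
  injection h

lemma notMem_descendants_or_of_adj (hT : T.IsTree) {a b : V} (hab : T.Adj a b) :
    a ∉ descendants T v b ∨ b ∉ descendants T v a := by
  obtain ⟨p, hp, -⟩ := hT.existsUnique_path a v
  by_cases hb : b ∈ p.support
  · right
    refine notMem_descendants.2 ⟨p.dropUntil b hb, hp.dropUntil hb, fun ha => ?_⟩
    have h := (hT.existsUnique_path a v).unique hp ((hp.dropUntil hb).dropUntil ha)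
    have h1 := (p.dropUntil b hb).length_dropUntil_le_length ha
    have h2 := SimpleGraph.Walk.length_dropUntil_lt_length hb hab.ne.symm
    rw [← h] at h1
    omega
  · exact .inl (notMem_descendants.2 ⟨p, hp, hb⟩)

lemma exists_child (hT : T.IsTree) (v : V) (e : T.edgeFinset) :
    ∃ u p, T.Adj u p ∧ (e : Sym2 V) = s(u, p) ∧ p ∉ descendants T v u := by
  obtain ⟨e, he⟩ := e
  induction e with
  | _ a b =>
    have hab : T.Adj a b := by simpa using he
    rcases notMem_descendants_or_of_adj (v := v) hT hab with h | h
    · exact ⟨b, a, hab.symm, Sym2.eq_swap, h⟩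
    · exact ⟨a, b, hab, rfl, h⟩

end Descendants

lemma sum_mul_mem_edge (D : Finset V) (f : V → ℝ) (t : ℝ) {a b : V} (hab : a ≠ b) :
    ∑ w ∈ D, f w * (if w ∈ s(a, b) then t else 0) =
      ((if a ∈ D then f a else 0) + if b ∈ D then f b else 0) * t := by
  have h : ∀ w, f w * (if w ∈ s(a, b) then t else 0) =
      (if a = w then f w * t else 0) + if b = w then f w * t else 0 := by
    intro w
    by_cases h1 : a = w
    · subst h1
      simp [hab.symm]
    · by_cases h2 : b = w <;> simp [h1, h2, Ne.symm h1, eq_comm (a := w)]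
  simp only [h, Finset.sum_add_distrib, Finset.sum_ite_eq, add_mul, ite_mul, zero_mul]

/-- Summing the constraints over the descendants of `u` with alternating signs leaves only the
edge joining `u` to its parent. -/
lemma Solves.sign_mul_eq {T : SimpleGraph V} {K s : V → ℝ} {c : T.edgeFinset → ℝ} (hT : T.IsTree)
    (hs : ∀ a b, T.Adj a b → s a + s b = 0) (hc : Solves T K c) {v u p : V} (hup : T.Adj u p)
    (hp : p ∉ descendants T v u) (e : T.edgeFinset) (he : (e : Sym2 V) = s(u, p)) :
    s u * c e = -∑ w ∈ descendants T v u, s w * K w := by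
  have h : ∑ w ∈ descendants T v u, s w * ∑ e : T.edgeFinset,
      (if w ∈ (e : Sym2 V) then c e else 0) = -∑ w ∈ descendants T v u, s w * K w := by
    rw [← Finset.sum_neg_distrib]
    exact Finset.sum_congr rfl fun w _ => by rw [hc w, mul_neg]
  rw [← h]
  simp only [Finset.mul_sum]
  rw [Finset.sum_comm, Finset.sum_eq_single e]
  · rw [he, sum_mul_mem_edge _ _ _ hup.ne, if_pos (self_mem_descendants u), if_neg hp, add_zero]
  · rintro ⟨e', he'⟩ - hne
    induction e' with
    | _ a b =>
      have hab : T.Adj a b := by simpa using he'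
      have key : ∀ x y, T.Adj x y → s(x, y) ≠ s(u, p) → x = u → y ∈ descendants T v u := by
        rintro x y hxy hn rfl
        by_contra hy
        exact hn (by rw [parent_unique hT hxy hup hy hp])
      have hn : s(a, b) ≠ s(u, p) := fun h => hne (Subtype.ext (h.trans he.symm))
      have hiff : a ∈ descendants T v u ↔ b ∈ descendants T v u := by
        by_cases ha : a = u
        · exact iff_of_true (ha.symm ▸ self_mem_descendants u) (key a b hab hn ha)
        by_cases hb : b = u
        · exact iff_of_true (key b a hab.symm (by rwa [Sym2.eq_swap]) hb)
            (hb.symm ▸ self_mem_descendants u)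
        exact mem_descendants_iff_of_adj hab ha hb
      rw [sum_mul_mem_edge _ _ _ hab.ne]
      by_cases hb : b ∈ descendants T v u <;> simp [hiff, hb, hs a b hab]
  · simp

/-- The linear map sending an edge function to its vertex sums. -/
def vertexSum (H : SimpleGraph V) : (H.edgeFinset → ℝ) →ₗ[ℝ] (V → ℝ) where
  toFun c v := ∑ e : H.edgeFinset, if v ∈ (e : Sym2 V) then c e else 0
  map_add' c d := by
    ext v
    simp only [Pi.add_apply, ← Finset.sum_add_distrib]
    exact Finset.sum_congr rfl fun e _ => by split_ifs <;> simp
  map_smul' r c := by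
    ext v
    simp [Finset.mul_sum]

lemma solves_iff {H : SimpleGraph V} {K : V → ℝ} {c : H.edgeFinset → ℝ} :
    Solves H K c ↔ vertexSum H c = -K :=
  funext_iff.symm

/-- The functional `f ↦ ∑ w, s w * f w`. -/
def signedSum (s : V → ℝ) : (V → ℝ) →ₗ[ℝ] ℝ where
  toFun f := ∑ w, s w * f w
  map_add' f g := by simp [mul_add, Finset.sum_add_distrib]
  map_smul' r f := by simp [Finset.mul_sum, mul_left_comm]

section Tree

variable {T : SimpleGraph V} {s : V → ℝ}

lemma vertexSum_injective (hT : T.IsTree) (hs : ∀ a b, T.Adj a b → s a + s b = 0)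
    (hs0 : ∀ a, s a ≠ 0) : Function.Injective (vertexSum T) := by
  rw [injective_iff_map_eq_zero]
  intro c hc
  ext e
  obtain ⟨v⟩ := hT.1.nonempty
  obtain ⟨u, p, hup, he, hp⟩ := exists_child hT v e
  have hc' : Solves T 0 c := solves_iff.2 (by rw [hc, neg_zero])
  simpa [hs0 u] using hc'.sign_mul_eq hT hs hup hp e he

lemma signedSum_vertexSum (hs : ∀ a b, T.Adj a b → s a + s b = 0) (c : T.edgeFinset → ℝ) :
    signedSum s (vertexSum T c) = 0 := by
  simp only [signedSum, vertexSum, LinearMap.coe_mk, AddHom.coe_mk, Finset.mul_sum]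
  rw [Finset.sum_comm]
  refine Finset.sum_eq_zero ?_
  rintro ⟨e, he⟩ -
  induction e with
  | _ a b =>
    have hab : T.Adj a b := by simpa using he
    rw [sum_mul_mem_edge _ _ _ hab.ne]
    simp [hs a b hab]

lemma range_vertexSum (hT : T.IsTree) (hs : ∀ a b, T.Adj a b → s a + s b = 0)
    (hs0 : ∀ a, s a ≠ 0) : LinearMap.range (vertexSum T) = LinearMap.ker (signedSum s) := by
  refine Submodule.eq_of_le_of_finrank_le ?_ ?_
  · rintro _ ⟨c, rfl⟩
    exact signedSum_vertexSum hs c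
  · obtain ⟨v⟩ := hT.1.nonempty
    have hne : signedSum s ≠ 0 := fun h => hs0 v (by
      simpa [signedSum, Pi.single_apply] using LinearMap.congr_fun h (Pi.single v 1))
    have h1 := Module.Dual.finrank_ker_add_one_of_ne_zero hne
    have h2 := LinearMap.finrank_range_of_inj (vertexSum_injective hT hs hs0)
    have h3 := hT.card_edgeFinset
    rw [Module.finrank_fintype_fun_eq_card] at h1 h2
    rw [Fintype.card_coe] at h2
    omega

lemma existsUnique_solves (hT : T.IsTree) (hs : ∀ a b, T.Adj a b → s a + s b = 0)
    (hs0 : ∀ a, s a ≠ 0) {K : V → ℝ} (hK : ∑ w, s w * K w = 0) :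
    ∃! c : T.edgeFinset → ℝ, Solves T K c := by
  have hmem : -K ∈ LinearMap.range (vertexSum T) := by
    rw [range_vertexSum hT hs hs0, LinearMap.mem_ker, map_neg, neg_eq_zero]
    exact hK
  obtain ⟨c, hc⟩ := hmem
  refine ⟨c, solves_iff.2 hc, fun d hd => ?_⟩
  exact vertexSum_injective hT hs hs0 ((solves_iff.1 hd).trans hc.symm)

lemma Solves.norm2_le (hT : T.IsTree) (hs : ∀ a b, T.Adj a b → s a + s b = 0)
    (hs1 : ∀ a, |s a| = 1) {K : V → ℝ} {c : T.edgeFinset → ℝ} (hc : Solves T K c) (v : V) :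
    norm2 T c ≤ ∑ u ∈ Finset.univ \ {v}, (∑ w ∈ descendants T v u, |K w|) ^ 2 := by
  choose child parent hadj heq hpar using exists_child hT v
  have hinj : Function.Injective child := by
    intro e e' h
    have hadj' := hadj e'
    have hpar' := hpar e'
    rw [← h] at hadj' hpar'
    refine Subtype.ext ?_
    rw [heq e, heq e', ← h, parent_unique hT (hadj e) hadj' (hpar e) hpar']
  calc norm2 T c ≤ ∑ e, (∑ w ∈ descendants T v (child e), |K w|) ^ 2 := by
        refine Finset.sum_le_sum fun e _ => ?_
        rw [← sq_abs (c e)]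
        refine pow_le_pow_left₀ (abs_nonneg _) ?_ 2
        have h := congrArg abs (hc.sign_mul_eq hT hs (hadj e) (hpar e) e (heq e))
        rw [abs_mul, hs1, one_mul, abs_neg] at h
        rw [h]
        refine (Finset.abs_sum_le_sum_abs _ _).trans_eq (Finset.sum_congr rfl fun w _ => ?_)
        rw [abs_mul, hs1, one_mul]
    _ = ∑ u ∈ Finset.univ.image child, (∑ w ∈ descendants T v u, |K w|) ^ 2 :=
        (Finset.sum_image (f := fun u => (∑ w ∈ descendants T v u, |K w|) ^ 2) hinj.injOn).symm
    _ ≤ _ := by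
        refine Finset.sum_le_sum_of_subset_of_nonneg ?_ fun _ _ _ => sq_nonneg _
        intro u hu
        obtain ⟨e, -, rfl⟩ := Finset.mem_image.1 hu
        simp only [Finset.mem_sdiff, Finset.mem_univ, true_and, Finset.mem_singleton]
        intro h
        have := hpar e
        rw [h] at this
        exact this (mem_descendants_root _)

end Tree

/-- For a finite tree `T` with at least two vertices, bipartition classes
`A, B` and `K : V → ℝ` with `∑_A K = ∑_B K`, the constraint system for `K` has a unique
solution `c`, and for every root `v` it satisfies
`‖c‖₂² ≤ ∑_{u ≠ v} (∑_{w ∈ D(u)} |K w|)²`. -/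
theorem statement9 (T : SimpleGraph V) (A B : Finset V) (K : V → ℝ)
    (htree : T.IsTree) (hcard : 2 ≤ Fintype.card V)
    (hAB : ∀ v : V, v ∈ A ↔ v ∉ B)
    (hbip : ∀ v w : V, T.Adj v w → ((v ∈ A ∧ w ∈ B) ∨ (v ∈ B ∧ w ∈ A)))
    (hK : ∑ a ∈ A, K a = ∑ b ∈ B, K b) :
    (∃! c : T.edgeFinset → ℝ, Solves T K c) ∧
      ∀ (v : V) (c : T.edgeFinset → ℝ), Solves T K c →
        norm2 T c ≤ ∑ u ∈ Finset.univ \ {v}, (∑ w ∈ descendants T v u, |K w|) ^ 2 := by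
  let s : V → ℝ := fun w => if w ∈ B then -1 else 1
  have hs : ∀ a b, T.Adj a b → s a + s b = 0 := by
    intro a b hab
    rcases hbip a b hab with ⟨h1, h2⟩ | ⟨h1, h2⟩
    · simp [s, (hAB a).1 h1, h2]
    · simp [s, (hAB b).1 h2, h1]
  have hs1 : ∀ a, |s a| = 1 := fun a => by
    by_cases h : a ∈ B <;> simp [s, h]
  have hs0 : ∀ a, s a ≠ 0 := fun a h => by simpa [h] using hs1 a
  have hA : A = Bᶜ := by
    ext v
    simp [hAB v]
  have hsum : ∑ w, s w * K w = 0 := by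
    rw [← Finset.sum_compl_add_sum B, ← hA]
    have h1 : ∑ w ∈ A, s w * K w = ∑ w ∈ A, K w :=
      Finset.sum_congr rfl fun w hw => by simp [s, (hAB w).1 hw]
    have h2 : ∑ w ∈ B, s w * K w = -∑ w ∈ B, K w := by
      rw [← Finset.sum_neg_distrib]
      exact Finset.sum_congr rfl fun w hw => by simp [s, hw]
    rw [h1, h2, hK, add_neg_cancel]
  exact ⟨existsUnique_solves htree hs hs0 hsum, fun v c hc => hc.norm2_le htree hs hs1 v⟩

end CS
end
end

section
/- Let T = (V,E,v) be a finite rooted tree with root v and height h, where the height is the maximum over w ∈ V of the length of the unique path from w to v. For u ∈ V let D(u) denote the set of descendants of u (vertices whose unique path to the root passes through u, including u itself). Then Σ_{u ∈ V∖{v}} |D(u)|² ≤ |V|² · h. -/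
open scoped Classical
noncomputable section

namespace CS

variable {V : Type*} [Fintype V] [DecidableEq V]

/-- The number of non-root vertices having `w` as a descendant is at most the distance
from `w` to the root. -/
theorem card_ancestors_le_dist (T : SimpleGraph V) (v w : V) (hT : T.Connected) :
    ((Finset.univ \ {v}).filter fun u => w ∈ descendants T v u).card ≤ T.dist w v := by
  obtain ⟨p, hp, hlen⟩ := hT.exists_path_of_dist w v
  have hsub : ((Finset.univ \ {v}).filter fun u => w ∈ descendants T v u) ⊆
      p.support.toFinset.erase v := by
    intro u hu
    simp only [descendants, Finset.mem_filter, Finset.mem_sdiff, Finset.mem_univ,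
      Finset.mem_singleton, true_and] at hu
    simp only [Finset.mem_erase, List.mem_toFinset]
    exact ⟨hu.1, hu.2 p hp⟩
  have hv : v ∈ p.support.toFinset := by simp
  have hcard := Finset.card_le_card hsub
  rw [Finset.card_erase_of_mem hv] at hcard
  have hle := p.support.toFinset_card_le
  rw [p.length_support] at hle
  omega

/-- Double counting of the pairs formed by a non-root vertex and one of its descendants. -/
theorem sum_card_descendants_le (T : SimpleGraph V) (v : V) (hT : T.Connected) :
    ∑ u ∈ Finset.univ \ {v}, (descendants T v u).card ≤ ∑ w, T.dist w v := by
  calc ∑ u ∈ Finset.univ \ {v}, (descendants T v u).card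
      = ∑ u ∈ Finset.univ \ {v}, ∑ w, if w ∈ descendants T v u then 1 else 0 := by simp
    _ = ∑ w, ((Finset.univ \ {v}).filter fun u => w ∈ descendants T v u).card := by
        rw [Finset.sum_comm]
        simp only [Finset.card_filter]
    _ ≤ ∑ w, T.dist w v := Finset.sum_le_sum fun w _ => card_ancestors_le_dist T v w hT

/-- In a finite rooted tree `(T, v)` of height `h` (the maximal length of a
path from a vertex to the root, i.e. the maximal distance to the root),
`∑_{u ≠ v} |D(u)|² ≤ |V|²·h`. -/
theorem statement12 (T : SimpleGraph V) (v : V) (htree : T.IsTree) :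
    ∑ u ∈ Finset.univ \ {v}, (descendants T v u).card ^ 2
      ≤ Fintype.card V ^ 2 * Finset.univ.sup (fun w => T.dist w v) := by
  calc ∑ u ∈ Finset.univ \ {v}, (descendants T v u).card ^ 2
      ≤ ∑ u ∈ Finset.univ \ {v}, Fintype.card V * (descendants T v u).card := by
        refine Finset.sum_le_sum fun u _ => ?_
        rw [sq]
        exact Nat.mul_le_mul_right _ (Finset.card_le_univ _)
    _ = Fintype.card V * ∑ u ∈ Finset.univ \ {v}, (descendants T v u).card := by
        rw [Finset.mul_sum]
    _ ≤ Fintype.card V * ∑ w, T.dist w v :=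
        Nat.mul_le_mul_left _ (sum_card_descendants_le T v htree.connected)
    _ ≤ Fintype.card V * (Fintype.card V * Finset.univ.sup (fun w => T.dist w v)) := by
        refine Nat.mul_le_mul_left _ ?_
        simpa using Finset.sum_le_card_nsmul Finset.univ (fun w => T.dist w v) _
          fun w hw => Finset.le_sup (f := fun w => T.dist w v) hw
    _ = Fintype.card V ^ 2 * Finset.univ.sup (fun w => T.dist w v) := by ring

end CS
end
end

section
/- Let G = (V,E) be a finite simple connected unicyclic undirected graph (i.e. |E| = |V|) whose unique cycle has odd length. Then for every function K : V → ℝ, the constraint system for K has exactly one solution c : E → ℝ. -/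
open scoped Classical
noncomputable section

namespace CS

variable {V : Type*} [Fintype V] [DecidableEq V]

/-- If the values at the two ends of every edge cancel, the values at the two ends of a walk
differ by the sign given by the parity of the length of the walk. -/
theorem eq_neg_one_pow_length_mul_of_walk {V R : Type*} [CommRing R] {G : SimpleGraph V}
    {y : V → R} (hy : ∀ a b, G.Adj a b → y a + y b = 0) {u v : V} (w : G.Walk u v) :
    y u = (-1) ^ w.length * y v := by
  induction w with
  | nil => simp
  | cons h p ih =>
    rw [SimpleGraph.Walk.length_cons, pow_succ, mul_neg_one, neg_mul, ← ih]
    exact eq_neg_of_add_eq_zero_left (hy _ _ h)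

/-- On a connected graph with a closed walk of odd length, a function whose values at the two
ends of every edge cancel is zero. -/
theorem eq_zero_of_adj_add_eq_zero {V R : Type*} [CommRing R] [NoZeroDivisors R] [CharZero R]
    {G : SimpleGraph V} (hconn : G.Connected) {v : V} (w : G.Walk v v) (hw : Odd w.length)
    {y : V → R} (hy : ∀ a b, G.Adj a b → y a + y b = 0) : y = 0 := by
  have hv : y v = 0 := by
    have h := eq_neg_one_pow_length_mul_of_walk hy w
    rw [hw.neg_one_pow, neg_one_mul] at h
    exact self_eq_neg.mp h
  ext u
  obtain ⟨p⟩ := hconn.preconnected u v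
  rw [eq_neg_one_pow_length_mul_of_walk hy p, hv, mul_zero, Pi.zero_apply]

/-- Over the reals, a matrix with as many rows as columns, possibly indexed by different types,
is bijective as a map on column vectors as soon as it is injective on row vectors. -/
theorem mulVec_bijective_of_vecMul_injective {m n : Type*} [Fintype m] [Fintype n]
    (hcard : Fintype.card n = Fintype.card m) (M : Matrix m n ℝ)
    (hM : Function.Injective M.vecMul) : Function.Bijective M.mulVec := by
  have hsurj : Function.Surjective M.vecMulLinear :=
    (LinearMap.injective_iff_surjective_of_finrank_eq_finrank (by simp [hcard])).mp hM
  have hinj : Function.Injective M.mulVecLin := by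
    rw [injective_iff_map_eq_zero]
    intro c hc
    obtain ⟨y, hy⟩ := hsurj c
    rw [Matrix.mulVecLin_apply] at hc
    rw [Matrix.vecMulLinear_apply] at hy
    rw [← dotProduct_self_eq_zero]
    nth_rewrite 1 [← hy]
    rw [← Matrix.dotProduct_mulVec, hc, dotProduct_zero]
  exact ⟨hinj, (LinearMap.injective_iff_surjective_of_finrank_eq_finrank (by simp [hcard])).mp hinj⟩

/-- The incidence matrix of `G`, with columns indexed by the edges of `G` only. -/
def edgeIncMatrix (G : SimpleGraph V) : Matrix V G.edgeFinset ℝ :=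
  Matrix.of fun v e => if v ∈ (e : Sym2 V) then 1 else 0

theorem solves_iff_mulVec_eq (G : SimpleGraph V) (K : V → ℝ) (c : G.edgeFinset → ℝ) :
    Solves G K c ↔ (edgeIncMatrix G).mulVec c = -K := by
  simp [Solves, funext_iff, Matrix.mulVec, dotProduct, edgeIncMatrix]

theorem vecMul_edgeIncMatrix_apply (G : SimpleGraph V) (y : V → ℝ) {a b : V} (h : G.Adj a b) :
    Matrix.vecMul y (edgeIncMatrix G) ⟨s(a, b), SimpleGraph.mem_edgeFinset.mpr h⟩ = y a + y b := by
  have hs : (Finset.univ.filter fun v => v = a ∨ v = b) = {a, b} := by ext; simp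
  simp [Matrix.vecMul, dotProduct, edgeIncMatrix, ← Finset.sum_filter, hs,
    Finset.sum_pair h.ne]

theorem vecMul_edgeIncMatrix_injective {G : SimpleGraph V} (hconn : G.Connected) {v : V}
    (w : G.Walk v v) (hw : Odd w.length) : Function.Injective (edgeIncMatrix G).vecMul := by
  refine (injective_iff_map_eq_zero (edgeIncMatrix G).vecMulLinear).mpr fun y hy => ?_
  refine eq_zero_of_adj_add_eq_zero hconn w hw fun a b h => ?_
  rw [← vecMul_edgeIncMatrix_apply G y h]
  exact congrFun hy _

/-- For a finite simple connected unicyclic graph (`|E| = |V|`) whose (unique)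
cycle has odd length, the constraint system for every `K : V → ℝ` has exactly one solution. -/
theorem statement14 (G : SimpleGraph V) (hconn : G.Connected)
    (hunicyclic : G.edgeFinset.card = Fintype.card V)
    (hoddcycle : ∃ (v : V) (w : G.Walk v v), w.IsCycle ∧ Odd w.length) :
    ∀ K : V → ℝ, ∃! c : G.edgeFinset → ℝ, Solves G K c := by
  intro K
  obtain ⟨v, w, -, hw⟩ := hoddcycle
  simp only [solves_iff_mulVec_eq]
  exact (mulVec_bijective_of_vecMul_injective (by rw [Fintype.card_coe, hunicyclic])
    (edgeIncMatrix G) (vecMul_edgeIncMatrix_injective hconn w hw)).existsUnique (-K)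

end CS
end
end

section
/- Let d̄ ≥ 3 be odd and n' ≥ 1, and let G be the 'glued stars' tree with vertex set {v₁,…,v_{d̄−1}} ∪ {t₁,…,t_{n'}} ∪ {u₁,…,u_{n'}}, where v₁,…,v_{d̄−1} form a path in this order, each t_i is adjacent to v₁, and each u_i is adjacent to v_{d̄−1}. Let K be the constant function K ≡ k for some k > 0. Then the constraint system for K on G has a unique solution c, and it satisfies ‖c‖₂² ≥ (d̄ − 2) · (n' − 1)² · k². -/
open scoped Classical
noncomputable section

namespace CS

variable {V : Type*} [Fintype V] [DecidableEq V]

/-- The base relation of the "glued stars" graph: vertices `Sum.inl i` for `i : Fin (d-1)`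
form a path `v₁, …, v_{d-1}` in this order, the `n'` vertices `Sum.inr (Sum.inl _)` (the
`t`'s) are attached to `v₁` (index 0), and the `n'` vertices `Sum.inr (Sum.inr _)` (the
`u`'s) are attached to `v_{d-1}` (index `d-2`). -/
def gluedRel (d n' : ℕ) :
    (Fin (d - 1) ⊕ (Fin n' ⊕ Fin n')) → (Fin (d - 1) ⊕ (Fin n' ⊕ Fin n')) → Prop
  | Sum.inl i, Sum.inl j => (j : ℕ) = (i : ℕ) + 1
  | Sum.inr (Sum.inl _), Sum.inl i => (i : ℕ) = 0
  | Sum.inr (Sum.inr _), Sum.inl i => (i : ℕ) = d - 2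
  | _, _ => False

/-- The "glued stars" tree from the paper (Fig. 3). -/
def gluedStars (d n' : ℕ) : SimpleGraph (Fin (d - 1) ⊕ (Fin n' ⊕ Fin n')) :=
  SimpleGraph.fromRel (gluedRel d n')

/-- The edges of the glued stars graph, indexed by the path edges and the leaves. -/
def gluedEdge (m n : ℕ) :
    Fin m ⊕ (Fin n ⊕ Fin n) → Sym2 (Fin (m + 2 - 1) ⊕ (Fin n ⊕ Fin n))
  | Sum.inl i => s(Sum.inl (i.castSucc : Fin (m + 1)), Sum.inl (i.succ : Fin (m + 1)))
  | Sum.inr (Sum.inl j) => s(Sum.inr (Sum.inl j), Sum.inl (0 : Fin (m + 1)))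
  | Sum.inr (Sum.inr j) => s(Sum.inr (Sum.inr j), Sum.inl (Fin.last m))

theorem gluedEdge_injective (m n : ℕ) : Function.Injective (gluedEdge m n) := by
  rintro (i | i | i) (j | j | j) h <;> simp [gluedEdge, Fin.ext_iff] at h ⊢ <;> omega

theorem gluedEdge_mem (m n : ℕ) (x : Fin m ⊕ (Fin n ⊕ Fin n)) :
    gluedEdge m n x ∈ (gluedStars (m + 2) n).edgeFinset := by
  rw [SimpleGraph.mem_edgeFinset]
  rcases x with (i | i | i) <;>
    simp [gluedEdge, gluedStars, gluedRel, Fin.ext_iff]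

theorem exists_gluedEdge_eq (m n : ℕ) {e : Sym2 (Fin (m + 2 - 1) ⊕ (Fin n ⊕ Fin n))}
    (he : e ∈ (gluedStars (m + 2) n).edgeFinset) : ∃ x, gluedEdge m n x = e := by
  rw [SimpleGraph.mem_edgeFinset] at he
  induction e with | _ v w
  rw [SimpleGraph.mem_edgeSet, gluedStars, SimpleGraph.fromRel_adj] at he
  have key : ∀ v w, gluedRel (m + 2) n v w → ∃ x, gluedEdge m n x = s(v, w) := by
    rintro (i | i | i) (j | j | j) h <;> simp only [gluedRel] at h
    · refine ⟨Sum.inl ⟨i, by have := j.2; omega⟩, ?_⟩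
      simp only [gluedEdge]
      congr 3
      exact Fin.ext h.symm
    · exact ⟨Sum.inr (Sum.inl i), by simp only [gluedEdge]; congr 3; exact Fin.ext h.symm⟩
    · exact ⟨Sum.inr (Sum.inr i), by simp only [gluedEdge]; congr 3; exact Fin.ext h.symm⟩
  rcases he.2 with h | h
  · exact key v w h
  · rw [Sym2.eq_swap]
    exact key w v h

/-- `gluedEdge` as a parametrization of the edge set. -/
def gluedEdgeEquiv (m n : ℕ) :
    Fin m ⊕ (Fin n ⊕ Fin n) ≃ (gluedStars (m + 2) n).edgeFinset :=
  Equiv.ofBijective (fun x => ⟨gluedEdge m n x, gluedEdge_mem m n x⟩)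
    ⟨fun _ _ h => gluedEdge_injective m n (congrArg Subtype.val h),
      fun e => (exists_gluedEdge_eq m n e.2).imp fun _ h => Subtype.ext h⟩

/-- The values of the solution of the constraint system for `K ≡ k`. -/
def gluedSol (m n : ℕ) (k : ℝ) : Fin m ⊕ (Fin n ⊕ Fin n) → ℝ
  | Sum.inl i => if Even (i : ℕ) then ((n : ℝ) - 1) * k else -(n * k)
  | Sum.inr _ => -k

theorem sum_path_incident {m : ℕ} (a : Fin m → ℝ) (i : Fin (m + 1)) :
    ∑ x : Fin m, (if i = x.castSucc ∨ i = x.succ then a x else 0) =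
      (∑ x : Fin m, if i = x.castSucc then a x else 0) +
        ∑ x : Fin m, if i = x.succ then a x else 0 := by
  rw [← Finset.sum_add_distrib]
  refine Finset.sum_congr rfl fun x _ => ?_
  have := x.castSucc_lt_succ.ne
  split_ifs <;> simp_all

/-- The constraint system on the glued stars graph, written in edge coordinates. -/
theorem solves_gluedStars_iff (m n : ℕ) (k : ℝ) (c : (gluedStars (m + 2) n).edgeFinset → ℝ) :
    Solves (gluedStars (m + 2) n) (fun _ => k) c ↔
      (∀ j, c (gluedEdgeEquiv m n (Sum.inr j)) = -k) ∧
      ∀ i : Fin (m + 1),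
        (∑ x : Fin m, if i = x.castSucc then c (gluedEdgeEquiv m n (Sum.inl x)) else 0) +
        (∑ x : Fin m, if i = x.succ then c (gluedEdgeEquiv m n (Sum.inl x)) else 0) +
        ((if i = 0 then -(n * k) else 0) + if i = Fin.last m then -(n * k) else 0) = -k := by
  have hsum : Solves (gluedStars (m + 2) n) (fun _ => k) c ↔
      ∀ v, ∑ x, (if v ∈ gluedEdge m n x then c (gluedEdgeEquiv m n x) else 0) = -k := by
    refine forall_congr' fun v => ?_
    rw [← (gluedEdgeEquiv m n).sum_comp]
    rfl
  have hleaf : (∀ v : Fin n ⊕ Fin n, ∑ x, (if Sum.inr v ∈ gluedEdge m n x then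
      c (gluedEdgeEquiv m n x) else 0) = -k) ↔
      ∀ j, c (gluedEdgeEquiv m n (Sum.inr j)) = -k := by
    refine forall_congr' fun v => ?_
    rcases v with v | v <;> simp [Fintype.sum_sum_type, gluedEdge]
  rw [hsum, Sum.forall, and_comm, hleaf]
  refine and_congr_right fun h => forall_congr' fun (i : Fin (m + 1)) => ?_
  rw [← sum_path_incident]
  simp only [Fintype.sum_sum_type, gluedEdge, h]
  have h0 (b : Fin (m + 1)) (j : Fin n ⊕ Fin n) :
      ((Sum.inl i : Fin (m + 2 - 1) ⊕ (Fin n ⊕ Fin n)) ∈ s(Sum.inr j, Sum.inl b)) ↔ i = b := by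
    simp
  have h1 (b b' : Fin (m + 1)) :
      ((Sum.inl i : Fin (m + 2 - 1) ⊕ (Fin n ⊕ Fin n)) ∈ s(Sum.inl b, Sum.inl b')) ↔
        i = b ∨ i = b' := by
    simp
  simp [h0, h1]

theorem path_equations_iff {p : ℕ} (a : Fin (p + 1) → ℝ) (s k : ℝ) :
    (∀ i : Fin (p + 2),
      (∑ x : Fin (p + 1), if i = x.castSucc then a x else 0) +
      (∑ x : Fin (p + 1), if i = x.succ then a x else 0) +
      ((if i = 0 then s else 0) + if i = Fin.last (p + 1) then s else 0) = -k) ↔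
    a 0 + s = -k ∧ (∀ j : Fin p, a j.castSucc + a j.succ = -k) ∧ a (Fin.last p) + s = -k := by
  rw [Fin.forall_fin_succ, Fin.forall_fin_succ']
  have hcast (j : Fin (p + 1)) :
      (∑ x : Fin (p + 1), if j.castSucc = x.castSucc then a x else 0) = a j := by
    simp only [Fin.castSucc_inj, Finset.sum_ite_eq, Finset.mem_univ, if_true]
  have hsucc (j : Fin (p + 1)) :
      (∑ x : Fin (p + 1), if j.succ = x.succ then a x else 0) = a j := by
    simp only [Fin.succ_inj, Finset.sum_ite_eq, Finset.mem_univ, if_true]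
  have hzero : (∑ x : Fin (p + 1), if 0 = x.succ then a x else 0) = 0 :=
    Finset.sum_eq_zero fun x _ => if_neg x.succ_ne_zero.symm
  have hlast : (∑ x : Fin (p + 1), if Fin.last (p + 1) = x.castSucc then a x else 0) = 0 :=
    Finset.sum_eq_zero fun x _ => if_neg x.castSucc_lt_last.ne'
  have hcast_zero := hcast 0
  rw [Fin.castSucc_zero] at hcast_zero
  have hzero_ne : (0 : Fin (p + 2)) ≠ Fin.last (p + 1) := Fin.last_pos.ne
  refine and_congr ?_ (and_congr (forall_congr' fun j => ?_) ?_)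
  · rw [hcast_zero, hzero, if_pos rfl, if_neg hzero_ne, add_zero, add_zero]
  · rw [hsucc, if_neg j.castSucc.succ_ne_zero, Fin.succ_castSucc, hcast,
      if_neg j.succ.castSucc_lt_last.ne, add_zero, add_zero, add_comm]
  · rw [hsucc, Fin.succ_last, hlast, if_neg hzero_ne.symm, if_pos rfl, zero_add, zero_add]

theorem solves_gluedStars_iff_eq {m : ℕ} (hm : Odd m) (n : ℕ) (k : ℝ)
    (c : (gluedStars (m + 2) n).edgeFinset → ℝ) :
    Solves (gluedStars (m + 2) n) (fun _ => k) c ↔ c ∘ gluedEdgeEquiv m n = gluedSol m n k := by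
  rw [solves_gluedStars_iff]
  obtain ⟨p, rfl⟩ : ∃ p, m = p + 1 := ⟨m - 1, by have := hm.pos; omega⟩
  have hp : Even p := by simpa [Nat.odd_add_one] using hm
  rw [path_equations_iff fun x => c (gluedEdgeEquiv (p + 1) n (Sum.inl x))]
  constructor
  · rintro ⟨h, hfirst, hstep, -⟩
    funext x
    rcases x with i | j
    · induction i using Fin.induction with
      | zero => simp [gluedSol]; linarith
      | succ j ih =>
        have hj := hstep j
        simp only [Function.comp_apply, gluedSol, Fin.val_castSucc, Fin.val_succ,
          Nat.even_add_one] at ih ⊢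
        split_ifs at ih ⊢ <;> first | contradiction | linarith
    · exact h j
  · intro h
    have h' (x) : c (gluedEdgeEquiv (p + 1) n x) = gluedSol (p + 1) n k x := congrFun h x
    simp only [h', gluedSol, Fin.val_castSucc, Fin.val_succ, Nat.even_add_one, Fin.val_last,
      Fin.val_zero, hp, Even.zero, if_true, implies_true, true_and]
    refine ⟨by ring, fun j => ?_, by ring⟩
    split_ifs <;> first | contradiction | ring

/-- For the glued-stars tree with odd `d ≥ 3` and `n' ≥ 1`, and the constant
function `K ≡ k` with `k > 0`, the constraint system has a unique solution `c`, and it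
satisfies `‖c‖₂² ≥ (d − 2)·(n' − 1)²·k²`. -/
theorem statement15 (d n' : ℕ) (hd3 : 3 ≤ d) (hdodd : Odd d) (hn : 1 ≤ n')
    (k : ℝ) (hk : 0 < k) :
    (∃! c : (gluedStars d n').edgeFinset → ℝ, Solves (gluedStars d n') (fun _ => k) c) ∧
      ∀ c : (gluedStars d n').edgeFinset → ℝ, Solves (gluedStars d n') (fun _ => k) c →
        ((d : ℝ) - 2) * ((n' : ℝ) - 1) ^ 2 * k ^ 2 ≤ norm2 (gluedStars d n') c := by
  obtain ⟨m, rfl⟩ : ∃ m, d = m + 2 := ⟨d - 2, by omega⟩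
  have hm : Odd m := by simpa [Nat.odd_add] using hdodd
  simp only [solves_gluedStars_iff_eq hm]
  refine ⟨⟨gluedSol m n' k ∘ (gluedEdgeEquiv m n').symm, by ext; simp, fun c hc => ?_⟩,
    fun c hc => ?_⟩
  · rw [← hc]; ext; simp
  · rw [norm2, ← (gluedEdgeEquiv m n').sum_comp, Fintype.sum_sum_type]
    have hc' (x) : c (gluedEdgeEquiv m n' x) = gluedSol m n' k x := congrFun hc x
    simp only [hc']
    have hle : ∀ i : Fin m, (((n' : ℝ) - 1) * k) ^ 2 ≤ gluedSol m n' k (Sum.inl i) ^ 2 := by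
      intro i
      have hn' : (1 : ℝ) ≤ n' := by exact_mod_cast hn
      simp only [gluedSol]
      split_ifs
      · exact le_rfl
      · nlinarith [sq_nonneg k]
    have hpath := Finset.sum_le_sum fun i (_ : i ∈ Finset.univ) => hle i
    have hleaf : 0 ≤ ∑ j, gluedSol m n' k (Sum.inr j) ^ 2 :=
      Finset.sum_nonneg fun _ _ => sq_nonneg _
    simp only [Finset.sum_const, Finset.card_univ, Fintype.card_fin, nsmul_eq_mul] at hpath
    push_cast
    linarith

end CS
end
end

section
/- Let ḡ ≥ 3 be odd, n > ḡ, and let G be the graph on n vertices {v₁,…,v_ḡ, w₁,…,w_{n−ḡ}} in which v₁,…,v_ḡ form a cycle in this order and each w_i is adjacent to v₁ (and there are no other edges). Let K be the constant function K ≡ k for some k > 0. Then the constraint system for K on G has a unique solution c, and it satisfies ‖c‖₂² ≥ ḡ · k² · (n − ḡ − 1)² / 4. -/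
open scoped Classical
noncomputable section

namespace CS

variable {V : Type*} [Fintype V] [DecidableEq V]

/-- The base relation of the graph from Fig. 4: the vertices `Sum.inl i`, `i : Fin g`, form a
cycle `v₁, …, v_g` in this order, and each of the `m` vertices `Sum.inr _` (the `w`'s) is
attached to `v₁` (index 0). -/
def cycleStarRel (g m : ℕ) : (Fin g ⊕ Fin m) → (Fin g ⊕ Fin m) → Prop
  | Sum.inl i, Sum.inl j => (j : ℕ) = ((i : ℕ) + 1) % g
  | Sum.inr _, Sum.inl i => (i : ℕ) = 0
  | _, _ => False

/-- The unicyclic graph of Fig. 4: a `g`-cycle with `m` pendant vertices at `v₁`. -/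
def cycleStar (g m : ℕ) : SimpleGraph (Fin g ⊕ Fin m) :=
  SimpleGraph.fromRel (cycleStarRel g m)

/-- The edges of `cycleStar g m`: `inl i` indexes the cycle edge from vertex `i` to `i + 1`,
and `inr j` the pendant edge at `w_j`. -/
def edgeOf (g m : ℕ) [NeZero g] : Fin g ⊕ Fin m → Sym2 (Fin g ⊕ Fin m)
  | Sum.inl i => s(Sum.inl i, Sum.inl (i + 1))
  | Sum.inr j => s(Sum.inr j, Sum.inl 0)

theorem fin_val_add_one {g : ℕ} [NeZero g] (i : Fin g) :
    ((i + 1 : Fin g) : ℕ) = ((i : ℕ) + 1) % g := by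
  rw [Fin.val_add, Fin.val_one', Nat.add_mod_mod]

theorem fin_add_one_ne {g : ℕ} [NeZero g] (hg : 3 ≤ g) (i : Fin g) : i + 1 ≠ i := by
  rw [Ne, Fin.ext_iff, fin_val_add_one]
  have := i.isLt
  rcases Nat.lt_or_ge (i + 1) g with h | h
  · rw [Nat.mod_eq_of_lt h]; omega
  · rw [show (i : ℕ) + 1 = g by omega, Nat.mod_self]; omega

theorem fin_add_one_add_one_ne {g : ℕ} [NeZero g] (hg : 3 ≤ g) (i : Fin g) :
    i + 1 + 1 ≠ i := by
  rw [Ne, Fin.ext_iff, fin_val_add_one, fin_val_add_one]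
  have := i.isLt
  rcases Nat.lt_or_ge (i + 1) g with h | h
  · rw [Nat.mod_eq_of_lt h]
    rcases Nat.lt_or_ge (i + 1 + 1) g with h' | h'
    · rw [Nat.mod_eq_of_lt h']; omega
    · rw [show (i : ℕ) + 1 + 1 = g by omega, Nat.mod_self]; omega
  · rw [show (i : ℕ) + 1 = g by omega, Nat.mod_self, Nat.mod_eq_of_lt] <;> omega

theorem edgeOf_injective {g : ℕ} [NeZero g] (hg : 3 ≤ g) (m : ℕ) :
    Function.Injective (edgeOf g m) := by
  rintro (i | i) (j | j) h <;> simp [edgeOf] at h ⊢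
  · rcases h with h | ⟨h, h'⟩
    · exact h
    · exact absurd (by rw [h', ← h]) (fin_add_one_add_one_ne hg i)
  · exact h

theorem edgeOf_mem {g : ℕ} [NeZero g] (hg : 3 ≤ g) (m : ℕ) (p : Fin g ⊕ Fin m) :
    edgeOf g m p ∈ (cycleStar g m).edgeFinset := by
  rw [SimpleGraph.mem_edgeFinset]
  rcases p with i | j
  · simp [edgeOf, cycleStar, cycleStarRel, fin_val_add_one, (fin_add_one_ne hg i).symm]
  · simp [edgeOf, cycleStar, cycleStarRel]

theorem exists_edgeOf_eq {g m : ℕ} [NeZero g] {e : Sym2 (Fin g ⊕ Fin m)}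
    (he : e ∈ (cycleStar g m).edgeFinset) : ∃ p, edgeOf g m p = e := by
  rw [SimpleGraph.mem_edgeFinset] at he
  have of_rel : ∀ x y, cycleStarRel g m x y → ∃ p, edgeOf g m p = s(x, y) := by
    rintro (i | i) (j | j) h
    · exact ⟨Sum.inl i, by
        rw [edgeOf, show i + 1 = j from Fin.ext ((fin_val_add_one i).trans h.symm)]⟩
    · exact h.elim
    · exact ⟨Sum.inr i, by rw [edgeOf, show j = 0 from Fin.ext (by simpa [cycleStarRel] using h)]⟩
    · exact h.elim
  induction e with
  | _ x y =>
    rw [SimpleGraph.mem_edgeSet, cycleStar, SimpleGraph.fromRel_adj] at he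
    rcases he.2 with h | h
    · exact of_rel x y h
    · rw [Sym2.eq_swap]
      exact of_rel y x h

/-- The indexing of the edges of `cycleStar g m` by `edgeOf`, as an equivalence. -/
def edgeEquiv {g : ℕ} [NeZero g] (hg : 3 ≤ g) (m : ℕ) :
    Fin g ⊕ Fin m ≃ (cycleStar g m).edgeFinset :=
  Equiv.ofBijective (fun p => ⟨edgeOf g m p, edgeOf_mem hg m p⟩)
    ⟨fun _ _ h => edgeOf_injective hg m (congrArg Subtype.val h),
      fun e => (exists_edgeOf_eq e.2).imp fun _ h => Subtype.ext h⟩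

/-- The constraint system of `cycleStar g m` in the coordinates given by `edgeEquiv`. -/
theorem solves_cycleStar_iff {g m : ℕ} [NeZero g] (hg : 3 ≤ g) (k : ℝ)
    (c : (cycleStar g m).edgeFinset → ℝ) :
    Solves (cycleStar g m) (fun _ => k) c ↔
      (∀ i : Fin g, c (edgeEquiv hg m (Sum.inl i)) + c (edgeEquiv hg m (Sum.inl (i + 1))) +
        (if i + 1 = 0 then ∑ j, c (edgeEquiv hg m (Sum.inr j)) else 0) = -k) ∧
      ∀ j, c (edgeEquiv hg m (Sum.inr j)) = -k := by
  have inl_eq (i : Fin g) : (∑ e : (cycleStar g m).edgeFinset,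
      if Sum.inl (i + 1) ∈ (e : Sym2 (Fin g ⊕ Fin m)) then c e else 0) =
      c (edgeEquiv hg m (Sum.inl i)) + c (edgeEquiv hg m (Sum.inl (i + 1))) +
        (if i + 1 = 0 then ∑ j, c (edgeEquiv hg m (Sum.inr j)) else 0) := by
    rw [← (edgeEquiv hg m).sum_comp, Fintype.sum_sum_type]
    congr 1
    · have split (x : Fin g) : (if Sum.inl (i + 1) ∈
          (edgeEquiv hg m (Sum.inl x) : Sym2 (Fin g ⊕ Fin m))
          then c (edgeEquiv hg m (Sum.inl x)) else 0) =
          (if i = x then c (edgeEquiv hg m (Sum.inl x)) else 0) +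
          (if i + 1 = x then c (edgeEquiv hg m (Sum.inl x)) else 0) := by
        have hx : Sum.inl (i + 1) ∈ (edgeEquiv hg m (Sum.inl x) : Sym2 (Fin g ⊕ Fin m)) ↔
            i + 1 = x ∨ i = x := by
          simp [edgeEquiv, edgeOf]
        have hne := fin_add_one_ne hg i
        simp only [hx]
        by_cases h : i = x
        · subst h; simp [hne]
        · simp [h]
      simp only [split, Finset.sum_add_distrib, Finset.sum_ite_eq, Finset.mem_univ, if_true]
    · have hj (j : Fin m) : Sum.inl (i + 1) ∈
          (edgeEquiv hg m (Sum.inr j) : Sym2 (Fin g ⊕ Fin m)) ↔ i + 1 = 0 := by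
        simp [edgeEquiv, edgeOf]
      simp only [hj]
      split_ifs <;> simp
  have inr_eq (j : Fin m) : (∑ e : (cycleStar g m).edgeFinset,
      if Sum.inr j ∈ (e : Sym2 (Fin g ⊕ Fin m)) then c e else 0) =
      c (edgeEquiv hg m (Sum.inr j)) := by
    rw [← (edgeEquiv hg m).sum_comp, Fintype.sum_sum_type]
    simp [edgeEquiv, edgeOf]
  constructor
  · intro h
    exact ⟨fun i => by rw [← inl_eq]; convert h (Sum.inl (i + 1)), fun j => by
      rw [← inr_eq]; convert h (Sum.inr j)⟩
  · rintro ⟨h₁, h₂⟩ (i | j)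
    · have h := h₁ (i - 1)
      rw [← inl_eq, sub_add_cancel] at h
      convert h
    · have h := h₂ j
      rw [← inr_eq] at h
      convert h

/-- The values of the solution: `-k` on pendant edges, and alternately `k (m - 1) / 2` and
`-k - k (m - 1) / 2` around the cycle. -/
def solution (g m : ℕ) (k : ℝ) : Fin g ⊕ Fin m → ℝ
  | Sum.inl i => if Even (i : ℕ) then k * (m - 1) / 2 else -k - k * (m - 1) / 2
  | Sum.inr _ => -k

theorem solves_cycleStar_iff_eq_solution {g m : ℕ} [NeZero g] (hg : 3 ≤ g) (hodd : Odd g) (k : ℝ)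
    (c : (cycleStar g m).edgeFinset → ℝ) :
    Solves (cycleStar g m) (fun _ => k) c ↔ ∀ p, c (edgeEquiv hg m p) = solution g m k p := by
  have heven : Even (g - 1) := Nat.Odd.sub_odd hodd odd_one
  have last_add_one : (⟨g - 1, by omega⟩ : Fin g) + 1 = 0 := by
    ext
    rw [fin_val_add_one, Fin.val_zero, show g - 1 + 1 = g by omega, Nat.mod_self]
  have mk_add_one (i : ℕ) (hi : i + 1 < g) :
      (⟨i, by omega⟩ : Fin g) + 1 = ⟨i + 1, hi⟩ := by
    ext
    rw [fin_val_add_one, Nat.mod_eq_of_lt hi]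
  have mk_ne (i : ℕ) (hi : i + 1 < g) : (⟨i + 1, hi⟩ : Fin g) ≠ 0 := by
    simp [Fin.ext_iff]
  rw [solves_cycleStar_iff hg]
  constructor
  · rintro ⟨h₁, h₂⟩
    have alternate (i : ℕ) (hi : i < g) : c (edgeEquiv hg m (Sum.inl ⟨i, hi⟩)) =
        if Even i then c (edgeEquiv hg m (Sum.inl 0))
        else -k - c (edgeEquiv hg m (Sum.inl 0)) := by
      induction i with
      | zero => simp
      | succ i ih =>
        have h := h₁ ⟨i, by omega⟩
        rw [mk_add_one i hi, if_neg (mk_ne i hi), ih (by omega)] at h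
        simp only [Nat.even_add_one]
        split_ifs at h ⊢ <;> linarith
    have h_zero : c (edgeEquiv hg m (Sum.inl 0)) = k * (m - 1) / 2 := by
      have h := h₁ ⟨g - 1, by omega⟩
      rw [last_add_one, alternate _ (by omega), if_pos heven, if_pos rfl] at h
      simp only [h₂, Finset.sum_const, Finset.card_univ, Fintype.card_fin, nsmul_eq_mul] at h
      linarith
    rintro (i | j)
    · simpa only [h_zero, solution] using alternate i i.isLt
    · exact h₂ j
  · intro h
    refine ⟨fun i => ?_, fun j => h _⟩
    simp only [h]
    obtain ⟨i, hi⟩ := i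
    rcases Nat.lt_or_ge (i + 1) g with hlt | hge
    · rw [mk_add_one i hlt, if_neg (mk_ne i hlt)]
      simp only [solution, Nat.even_add_one]
      split_ifs <;> ring
    · obtain rfl : i = g - 1 := by omega
      rw [last_add_one, if_pos rfl]
      simp only [solution, if_pos heven, Fin.val_zero, Even.zero, if_true, Finset.sum_const,
        Finset.card_univ, Fintype.card_fin, nsmul_eq_mul]
      ring

theorem le_sum_solution_sq (g : ℕ) {m : ℕ} (hm : 1 ≤ m) {k : ℝ} (hk : 0 < k) :
    (g : ℝ) * k ^ 2 * ((m : ℝ) - 1) ^ 2 / 4 ≤ ∑ p, solution g m k p ^ 2 := by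
  have hm' : (0 : ℝ) ≤ m - 1 := sub_nonneg.2 (by exact_mod_cast hm)
  have hcycle : ∀ i : Fin g, (k * (m - 1) / 2) ^ 2 ≤ solution g m k (Sum.inl i) ^ 2 := by
    intro i
    have := mul_nonneg hk.le hm'
    simp only [solution]
    split_ifs
    · exact le_rfl
    · nlinarith
  calc (g : ℝ) * k ^ 2 * ((m : ℝ) - 1) ^ 2 / 4 = ∑ _i : Fin g, (k * (m - 1) / 2) ^ 2 := by
        simp only [Finset.sum_const, Finset.card_univ, Fintype.card_fin, nsmul_eq_mul]
        ring
    _ ≤ ∑ i : Fin g, solution g m k (Sum.inl i) ^ 2 := Finset.sum_le_sum fun i _ => hcycle i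
    _ ≤ ∑ p, solution g m k p ^ 2 := by
        rw [Fintype.sum_sum_type]
        exact le_add_of_nonneg_right (Finset.sum_nonneg fun _ _ => sq_nonneg _)

/-- For odd `g ≥ 3`, `n > g`, the graph on `n` vertices consisting of a
`g`-cycle `v₁,…,v_g` with `n − g` pendant vertices attached to `v₁`, and the constant
function `K ≡ k` with `k > 0`, the constraint system has a unique solution `c`, and it
satisfies `‖c‖₂² ≥ g·k²·(n − g − 1)²/4`. -/
theorem statement16 (g n : ℕ) (hg3 : 3 ≤ g) (hgodd : Odd g) (hgn : g < n)
    (k : ℝ) (hk : 0 < k) :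
    (∃! c : (cycleStar g (n - g)).edgeFinset → ℝ, Solves (cycleStar g (n - g)) (fun _ => k) c) ∧
      ∀ c : (cycleStar g (n - g)).edgeFinset → ℝ, Solves (cycleStar g (n - g)) (fun _ => k) c →
        (g : ℝ) * k ^ 2 * ((n : ℝ) - g - 1) ^ 2 / 4 ≤ norm2 (cycleStar g (n - g)) c := by
  have : NeZero g := ⟨by omega⟩
  have hsolves := solves_cycleStar_iff_eq_solution (m := n - g) hg3 hgodd k
  refine ⟨⟨solution g (n - g) k ∘ (edgeEquiv hg3 (n - g)).symm, ?_, ?_⟩, ?_⟩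
  · exact (hsolves _).2 fun p => by simp
  · intro c hc
    exact ((edgeEquiv hg3 (n - g)).eq_comp_symm _ _).2 (funext ((hsolves c).1 hc))
  · intro c hc
    have h := le_sum_solution_sq g (m := n - g) (by omega) hk
    rw [Nat.cast_sub hgn.le] at h
    rw [norm2, ← (edgeEquiv hg3 (n - g)).sum_comp]
    simpa only [(hsolves c).1 hc] using h

end CS
end
end
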